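/- arXiv:math/0207041 — 5 statements merged into one kernel-verified Lean document; each statement's English description precedes it below -/
import Mathlib

section
/- Let w(n) be a stable sequence with limiting partition (S_1,…,S_r), where r ≥ 2. Then f_{2|S_1|}(λ, w(n)) → 0 as n → ∞; equivalently, the (|S_1|, |S_1|+1) entry of the matrix f(λ, w(n)) tends to 0. -/
noncomputable section
open Polynomial Filter Topology ENNReal

/-- The inner product `⟨p,q⟩_v = ∑ₖ p(μₖ)q(μₖ)vₖ`. -/
def ip {m : ℕ} (μ v : Fin m → ℝ) (p q : ℝ[X]) : ℝ :=
  ∑ k, p.eval (μ k) * q.eval (μ k) * v k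

/-- Pair `(pₙ, pₙ₋₁)` of monic orthogonal polynomials (with `p₋₁ = 0`). -/
def opAux {m : ℕ} (μ v : Fin m → ℝ) : ℕ → ℝ[X] × ℝ[X]
  | 0 => (1, 0)
  | n + 1 =>
    let P := opAux μ v n
    ((X - C (ip μ v P.1 (X * P.1) / ip μ v P.1 P.1)) * P.1
        - C (ip μ v P.1 P.1 / ip μ v P.2 P.2) * P.2, P.1)

/-- The `n`-th monic orthogonal polynomial of the recursion. -/
def op {m : ℕ} (μ v : Fin m → ℝ) (n : ℕ) : ℝ[X] := (opAux μ v n).1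

/-- The entry `a_N` of the Jacobi matrix construction: for odd `N = 2n+1` the diagonal
entry `a_{2n+1} = ⟨pₙ, Xpₙ⟩/⟨pₙ,pₙ⟩`, for even `N = 2n` the off-diagonal entry
`a_{2n} = √(⟨pₙ,pₙ⟩/⟨pₙ₋₁,pₙ₋₁⟩)`. -/
def fEnt {m : ℕ} (μ v : Fin m → ℝ) (N : ℕ) : ℝ :=
  if N % 2 = 1 then
    ip μ v (op μ v (N / 2)) (X * op μ v (N / 2)) / ip μ v (op μ v (N / 2)) (op μ v (N / 2))
  else
    Real.sqrt (ip μ v (op μ v (N / 2)) (op μ v (N / 2)) /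
      ip μ v (op μ v (N / 2 - 1)) (op μ v (N / 2 - 1)))

/-- The symmetric tridiagonal matrix `f(μ, v)` with diagonal `a₁,a₃,…` and
sub/super-diagonal `a₂,a₄,…`. -/
def Jmat {m : ℕ} (μ v : Fin m → ℝ) : Matrix (Fin m) (Fin m) ℝ :=
  Matrix.of fun i j =>
    if i = j then fEnt μ v (2 * (i : ℕ) + 1)
    else if (i : ℕ) + 1 = (j : ℕ) ∨ (j : ℕ) + 1 = (i : ℕ) then fEnt μ v ((i : ℕ) + (j : ℕ) + 1)
    else 0

/-- Restriction of `g : Fin d → ℝ` to a subset `Q`, reindexed in increasing order. -/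
def restr {d : ℕ} (Q : Finset (Fin d)) (g : Fin d → ℝ) : Fin Q.card → ℝ :=
  fun k => g ((Q.orderIsoOfFin rfl) k).1

/-- Leading `i × i` principal submatrix. -/
def leadSub {d : ℕ} (J : Matrix (Fin d) (Fin d) ℝ) (i : ℕ) (h : i ≤ d) :
    Matrix (Fin i) (Fin i) ℝ :=
  Matrix.of fun a b => J ⟨a.1, lt_of_lt_of_le a.2 h⟩ ⟨b.1, lt_of_lt_of_le b.2 h⟩

/-- A sequence of positive weight vectors is stable if all pairwise ratios converge
in `[0,∞]`. -/
def Stable {d : ℕ} (w : ℕ → Fin d → ℝ) : Prop :=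
  (∀ n i, 0 < w n i) ∧
    ∀ i j : Fin d, ∃ L : ℝ≥0∞,
      Tendsto (fun n => ENNReal.ofReal (w n i / w n j)) atTop (𝓝 L)

/-- `S : Fin r → Finset (Fin d)` is an ordered partition of `{0,…,d-1}`. -/
def OrdPart {d r : ℕ} (S : Fin r → Finset (Fin d)) : Prop :=
  (∀ j, (S j).Nonempty) ∧ (∀ j k, j ≠ k → Disjoint (S j) (S k)) ∧
    Finset.univ.biUnion S = (Finset.univ : Finset (Fin d))

/-- `S` is the limiting partition of the stable sequence `w`. -/
def LimPart {d r : ℕ} (w : ℕ → Fin d → ℝ) (S : Fin r → Finset (Fin d)) : Prop :=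
  OrdPart S ∧
  (∀ i j : Fin d, (∃ a, i ∈ S a ∧ j ∈ S a) ↔
      ∃ L : ℝ, 0 < L ∧ Tendsto (fun n => w n i / w n j) atTop (𝓝 L)) ∧
  (∀ a b : Fin r, a < b → ∀ i ∈ S a, ∀ j ∈ S b,
      Tendsto (fun n => w n i / w n j) atTop atTop)

/-- The constant `C_i^T = ∏_{t ∈ T} (λ_t − λ_i)²`. -/
def Cc {d : ℕ} (lam : Fin d → ℝ) (i : Fin d) (T : Finset (Fin d)) : ℝ :=
  ∏ t ∈ T, (lam t - lam i) ^ 2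

/-- Offset `∑_{k<j} |S_k|` of the `j`-th block. -/
def offS {d r : ℕ} (S : Fin r → Finset (Fin d)) (j : Fin r) : ℕ :=
  ∑ k ∈ Finset.univ.filter (· < j), (S k).card

/-- The block-diagonal matrix whose `j`-th block (in rows/columns
`offS S j, …, offS S j + |S_j| - 1`) is `Jmat (restr (S j) lam) (restr (S j) (v j))`. -/
def blockDiag {d r : ℕ} (lam : Fin d → ℝ) (S : Fin r → Finset (Fin d))
    (v : Fin r → Fin d → ℝ) : Matrix (Fin d) (Fin d) ℝ :=
  Matrix.of fun p q =>
    ∑ j : Fin r,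
      if h : offS S j ≤ (p : ℕ) ∧ (p : ℕ) < offS S j + (S j).card ∧
          offS S j ≤ (q : ℕ) ∧ (q : ℕ) < offS S j + (S j).card then
        Jmat (restr (S j) lam) (restr (S j) (v j))
          ⟨(p : ℕ) - offS S j, by omega⟩ ⟨(q : ℕ) - offS S j, by omega⟩
      else 0

/-- Nonempty subsets of `Fin d`. -/
abbrev NES (d : ℕ) := {S : Finset (Fin d) // S.Nonempty}

/-- The ambient Euclidean space of families `(w^S)` indexed by nonempty subsets. -/
abbrev Ew (d : ℕ) := NES d → Fin d → ℝ

/-- The blow-up `B` (normalized representatives): support, nonnegativity,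
normalization, and the quadratic equations. -/
def Bset {d : ℕ} (lam : Fin d → ℝ) : Set (Ew d) :=
  {w | (∀ S : NES d, ∀ n, n ∉ S.1 → w S n = 0) ∧
    (∀ S n, 0 ≤ w S n) ∧
    (∀ S : NES d, ∑ n ∈ S.1, w S n = 1) ∧
    ∀ R S : NES d, R.1 ⊆ S.1 → ∀ i ∈ R.1, ∀ j ∈ R.1,
      Cc lam i (S.1 \ R.1) * w R j * w S i = Cc lam j (S.1 \ R.1) * w R i * w S j}

/-- `𝒥̄^Λ`: symmetric tridiagonal matrices with nonnegative off-diagonal entries and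
characteristic polynomial `∏ (X − λ_k)`. -/
def Jset {d : ℕ} (lam : Fin d → ℝ) : Set (Matrix (Fin d) (Fin d) ℝ) :=
  {J | (∀ i j, J i j = J j i) ∧
    (∀ i j : Fin d, (i : ℕ) + 2 ≤ (j : ℕ) ∨ (j : ℕ) + 2 ≤ (i : ℕ) → J i j = 0) ∧
    (∀ i j : Fin d, (i : ℕ) + 1 = (j : ℕ) → 0 ≤ J i j) ∧
    J.charpoly = ∏ k, (X - C (lam k))}

/-- `K_j = S_j ∪ S_{j+1} ∪ … ∪ S_r`. -/
def Kof {d r : ℕ} (S : Fin r → Finset (Fin d)) (j : Fin r) : Finset (Fin d) :=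
  (Finset.univ.filter (j ≤ ·)).biUnion S

/-- The piece `Z(P)` of `B` corresponding to the ordered partition `P = (S_1,…,S_r)`:
for every nonempty `T`, the support of `w^T` is `T ∩ S_{i(T,P)}`. -/
def Zset {d : ℕ} (lam : Fin d → ℝ) {r : ℕ} (S : Fin r → Finset (Fin d)) : Set (Ew d) :=
  {w | w ∈ Bset lam ∧ ∀ T : NES d, ∃ j : Fin r, T.1 ⊆ Kof S j ∧
    (∀ k, T.1 ⊆ Kof S k → k ≤ j) ∧ ∀ n : Fin d, w T n ≠ 0 ↔ n ∈ T.1 ∧ n ∈ S j}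

/-- `R ⪯ S`: the ordered partition `R` refines `S`, i.e. `R` is the concatenation of
ordered partitions of `S_1`, then `S_2`, etc. -/
def Refines {d q r : ℕ} (R : Fin q → Finset (Fin d)) (S : Fin r → Finset (Fin d)) : Prop :=
  ∃ b : Fin (r + 1) → ℕ, b 0 = 0 ∧ b (Fin.last r) = q ∧
    (∀ i j : Fin (r + 1), i ≤ j → b i ≤ b j) ∧
    ∀ i : Fin r, S i = (Finset.univ.filter
      (fun k : Fin q => b i.castSucc ≤ (k : ℕ) ∧ (k : ℕ) < b i.succ)).biUnion R

/-- The `j`-th consecutive interval `I_j(T)` of lengths `|T_1|,…,|T_r|`. -/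
def Iint {d r : ℕ} (T : Fin r → Finset (Fin d)) (j : Fin r) : Finset (Fin d) :=
  Finset.univ.filter (fun m : Fin d => offS T j ≤ (m : ℕ) ∧ (m : ℕ) < offS T j + (T j).card)

/-- `H(T) = {σ : σ(T_j) = I_j(T) for all j}`. -/
def Hset {d r : ℕ} (T : Fin r → Finset (Fin d)) : Set (Equiv.Perm (Fin d)) :=
  {σ | ∀ j, (T j).image σ = Iint T j}

/-- Interval Young subgroups: setwise stabilizers of a division of `{0,…,d-1}` into
consecutive intervals. -/
def IsIntervalYoung {d : ℕ} (G : Set (Equiv.Perm (Fin d))) : Prop :=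
  ∃ (q : ℕ) (c : Fin q → Finset (Fin d)), OrdPart c ∧ (∀ j : Fin q, c j = Iint c j) ∧
    G = {τ : Equiv.Perm (Fin d) | ∀ j, (c j).image ⇑τ = c j}

/-- Number of surjections from an `a`-element set onto a `b`-element set. -/
def Surj (a b : ℕ) : ℕ := Fintype.card {f : Fin a → Fin b // Function.Surjective f}

/-- The Euler characteristic `χ_d = ∑_{q=1}^d (−2)^{d−q}·Surj(d,q)`. -/
def chi (a : ℕ) : ℝ := ∑ q ∈ Finset.Icc 1 a, (-2 : ℝ) ^ (a - q) * (Surj a q : ℝ)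

section InnerProduct

variable {m : ℕ} (μ v : Fin m → ℝ)

lemma ip_comm (p q : ℝ[X]) : ip μ v p q = ip μ v q p := by
  simp only [ip, mul_comm (p.eval _)]

lemma ip_add_right (p q r : ℝ[X]) : ip μ v p (q + r) = ip μ v p q + ip μ v p r := by
  simp only [ip, eval_add, mul_add, add_mul, Finset.sum_add_distrib]

lemma ip_sub_right (p q r : ℝ[X]) : ip μ v p (q - r) = ip μ v p q - ip μ v p r := by
  simp only [ip, eval_sub, mul_sub, sub_mul, Finset.sum_sub_distrib]

lemma ip_C_mul_right (c : ℝ) (p q : ℝ[X]) : ip μ v p (C c * q) = c * ip μ v p q := by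
  simp only [ip, eval_mul, eval_C, Finset.mul_sum]
  exact Finset.sum_congr rfl fun _ _ => by ring

lemma ip_X_mul_right (p q : ℝ[X]) : ip μ v p (X * q) = ip μ v (X * p) q := by
  simp only [ip, eval_mul, eval_X]
  exact Finset.sum_congr rfl fun _ _ => by ring

lemma ip_self_nonneg (hv : ∀ i, 0 < v i) (p : ℝ[X]) : 0 ≤ ip μ v p p :=
  Finset.sum_nonneg fun k _ => mul_nonneg (mul_self_nonneg _) (hv k).le

end InnerProduct

lemma degree_sub_coeff_mul_monic_lt {P q : ℝ[X]} {n : ℕ} (hP : P.Monic) (hn : P.natDegree = n)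
    (hq : q.degree < (n + 1 : ℕ)) : (q - C (q.coeff n) * P).degree < n := by
  rw [degree_lt_iff_coeff_zero] at hq ⊢
  intro j hj
  rcases hj.eq_or_lt with rfl | hj
  · have : P.coeff n = 1 := hn ▸ hP.coeff_natDegree
    simp [this]
  · simp [hq j hj, coeff_eq_zero_of_natDegree_lt (hn ▸ hj)]

/-- A monic polynomial of degree `#T - 1` is bounded away from zero on the nodes in `T`. -/
lemma one_le_ip_self_mul_sum {m : ℕ} {μ v : Fin m → ℝ} (hμ : Function.Injective μ)
    (hv : ∀ i, 0 < v i) {P : ℝ[X]} (hP : P.Monic) (T : Finset (Fin m))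
    (hT : P.natDegree + 1 = T.card) :
    1 ≤ ip μ v P P * ∑ k ∈ T, ((∏ j ∈ T.erase k, (μ k - μ j))⁻¹) ^ 2 / v k := by
  have h1 : (1 : ℝ) = ∑ k ∈ T, P.eval (μ k) * (∏ j ∈ T.erase k, (μ k - μ j))⁻¹ := by
    rw [← hP.leadingCoeff, Lagrange.leadingCoeff_eq_sum (s := T) (v := μ) hμ.injOn]
    · simp only [div_eq_mul_inv]
    · rw [degree_eq_natDegree hP.ne_zero, ← hT]
      norm_cast
  have h2 := Finset.sum_sq_le_sum_mul_sum_of_sq_le_mul T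
    (r := fun k => P.eval (μ k) * (∏ j ∈ T.erase k, (μ k - μ j))⁻¹)
    (f := fun k => P.eval (μ k) * P.eval (μ k) * v k)
    (g := fun k => ((∏ j ∈ T.erase k, (μ k - μ j))⁻¹) ^ 2 / v k)
    (fun k _ => mul_nonneg (mul_self_nonneg _) (hv k).le)
    (fun k _ => div_nonneg (sq_nonneg _) (hv k).le)
    (fun k _ => le_of_eq (by have := (hv k).ne'; field_simp))
  rw [← h1, one_pow] at h2
  refine h2.trans (mul_le_mul_of_nonneg_right ?_ ?_)
  · exact Finset.sum_le_sum_of_subset_of_nonneg (Finset.subset_univ T)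
      fun k _ _ => mul_nonneg (mul_self_nonneg _) (hv k).le
  · exact Finset.sum_nonneg fun k _ => div_nonneg (sq_nonneg _) (hv k).le

lemma ip_self_pos {m : ℕ} {μ v : Fin m → ℝ} (hμ : Function.Injective μ)
    (hv : ∀ i, 0 < v i) {P : ℝ[X]} (hP : P.Monic) (hm : P.natDegree < m) : 0 < ip μ v P P := by
  obtain ⟨T, -, hT⟩ := Finset.exists_subset_card_eq (s := (Finset.univ : Finset (Fin m)))
    (n := P.natDegree + 1) (by simpa using hm)
  refine (ip_self_nonneg μ v hv P).lt_of_ne fun h => ?_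
  have := one_le_ip_self_mul_sum hμ hv hP T hT.symm
  rw [← h, zero_mul] at this
  linarith

/-- The recursion produces monic orthogonal polynomials. The last two conjuncts record how the
previous polynomial pairs with lower degree polynomials. -/
lemma opAux_orthogonal {m : ℕ} {μ v : Fin m → ℝ} (hμ : Function.Injective μ)
    (hv : ∀ i, 0 < v i) (n : ℕ) (hn : n ≤ m) :
    (opAux μ v n).1.Monic ∧ (opAux μ v n).1.natDegree = n ∧
    (∀ q : ℝ[X], q.degree < n → ip μ v (opAux μ v n).1 q = 0) ∧
    (opAux μ v n).2.degree < n ∧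
    (∀ q : ℝ[X], q.degree < n → ip μ v (opAux μ v n).2 q =
      q.coeff (n - 1) * ip μ v (opAux μ v n).2 (opAux μ v n).2) ∧
    (n = 0 ∨ ip μ v (opAux μ v n).2 (opAux μ v n).2 ≠ 0) := by
  induction n with
  | zero => simp +contextual [opAux, ip]
  | succ n ih =>
    obtain ⟨hP, hPn, hPo, hQn, hQo, hQ0⟩ := ih (by omega)
    have hpos := ip_self_pos hμ hv hP (by omega)
    simp only [opAux]
    set P := (opAux μ v n).1
    set Q := (opAux μ v n).2
    set a := ip μ v P (X * P) / ip μ v P P with ha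
    set b := ip μ v P P / ip μ v Q Q with hb
    have hPdeg : P.degree = n := by rw [degree_eq_natDegree hP.ne_zero, hPn]
    have hmon : ((X - C a) * P).Monic := (monic_X_sub_C a).mul hP
    have hdeg : ((X - C a) * P).natDegree = n + 1 := by
      rw [(monic_X_sub_C a).natDegree_mul hP, natDegree_X_sub_C, hPn, add_comm]
    have hlt : (C b * Q).degree < ((X - C a) * P).degree := by
      rw [degree_eq_natDegree hmon.ne_zero, hdeg]
      calc (C b * Q).degree ≤ Q.degree := by
            rw [← smul_eq_C_mul]
            exact degree_smul_le b Q
        _ < n := hQn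
        _ < (n + 1 : ℕ) := by exact_mod_cast n.lt_succ_self
    have hPpair : ∀ q : ℝ[X], q.degree < (n + 1 : ℕ) →
        ip μ v P q = q.coeff n * ip μ v P P := fun q hq => by
      have := hPo _ (degree_sub_coeff_mul_monic_lt hP hPn hq)
      rw [ip_sub_right, ip_C_mul_right] at this
      linarith
    have hexp : ∀ q, ip μ v ((X - C a) * P - C b * Q) q =
        ip μ v P (X * q) - a * ip μ v P q - b * ip μ v Q q := fun q => by
      rw [ip_comm, sub_mul, ip_sub_right, ip_sub_right, ip_C_mul_right, ip_C_mul_right,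
        ip_comm μ v q, ip_comm μ v q, ip_comm μ v q, ip_X_mul_right]
    refine ⟨hmon.sub_of_left hlt, ?_, fun q hq => ?_, ?_, ?_, Or.inr hpos.ne'⟩
    · rw [natDegree_eq_of_degree_eq (degree_sub_eq_left_of_degree_lt hlt), hdeg]
    · set r := q - C (q.coeff n) * P with hr
      have hrn : r.degree < n := degree_sub_coeff_mul_monic_lt hP hPn hq
      have hrP : ip μ v ((X - C a) * P - C b * Q) P = 0 := by
        rw [hexp, ip_comm μ v Q P, hPo Q hQn, ha]
        field_simp
        ring
      have hrr : ip μ v ((X - C a) * P - C b * Q) r = 0 := by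
        rw [hexp, hPo r hrn, hQo r hrn]
        have hX : (X * r).degree < ((n + 1 : ℕ) : WithBot ℕ) := by
          rw [degree_lt_iff_coeff_zero] at hrn ⊢
          intro j hj
          obtain ⟨j, rfl⟩ : ∃ i, j = i + 1 := ⟨j - 1, by omega⟩
          rw [coeff_X_mul]
          exact hrn j (by omega)
        rw [hPpair _ hX]
        rcases Nat.eq_zero_or_pos n with rfl | h
        · have : r = 0 := by simpa using hrn
          simp [this]
        · have hQ0 := hQ0.resolve_left h.ne'
          obtain ⟨k, rfl⟩ : ∃ i, n = i + 1 := ⟨n - 1, by omega⟩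
          rw [coeff_X_mul, Nat.add_sub_cancel, hb]
          field_simp
          ring
      have hq' : q = r + C (q.coeff n) * P := by rw [hr]; ring
      rw [hq', ip_add_right, ip_C_mul_right, hrP, hrr]
      ring
    · rw [hPdeg]; exact_mod_cast n.lt_succ_self
    · simpa using hPpair

/-- Among monic polynomials of degree `n`, the orthogonal polynomial has minimal norm. -/
lemma ip_op_self_le {m : ℕ} {μ v : Fin m → ℝ} (hμ : Function.Injective μ)
    (hv : ∀ i, 0 < v i) {n : ℕ} (hn : n ≤ m) {q : ℝ[X]} (hq : q.Monic) (hqn : q.natDegree = n) :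
    ip μ v (op μ v n) (op μ v n) ≤ ip μ v q q := by
  obtain ⟨hP, hPn, hPo, -⟩ := opAux_orthogonal hμ hv n hn
  change (op μ v n).Monic at hP
  change (op μ v n).natDegree = n at hPn
  change ∀ q : ℝ[X], q.degree < n → ip μ v (op μ v n) q = 0 at hPo
  have hqd : q.degree < (n + 1 : ℕ) := by
    rw [degree_eq_natDegree hq.ne_zero, hqn]
    exact_mod_cast n.lt_succ_self
  have hlt := degree_sub_coeff_mul_monic_lt hP hPn hqd
  have h1 : q.coeff n = 1 := hqn ▸ hq.coeff_natDegree
  rw [h1, C_1, one_mul] at hlt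
  set r := q - op μ v n with hr
  have hq' : q = op μ v n + r := by rw [hr]; ring
  have hPr := hPo r hlt
  rw [hq', ip_add_right, ip_comm μ v (_ + _), ip_comm μ v (_ + _), ip_add_right, ip_add_right,
    ip_comm μ v r, hPr]
  linarith [ip_self_nonneg μ v hv r]

lemma ip_op_ratio_le {m : ℕ} {μ v : Fin m → ℝ} (hμ : Function.Injective μ)
    (hv : ∀ i, 0 < v i) (T : Finset (Fin m)) (hT : T.Nonempty) :
    ip μ v (op μ v T.card) (op μ v T.card) / ip μ v (op μ v (T.card - 1)) (op μ v (T.card - 1)) ≤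
      ∑ j, ∑ k ∈ T, (∏ t ∈ T, (μ j - μ t)) ^ 2 *
        ((∏ j ∈ T.erase k, (μ k - μ j))⁻¹) ^ 2 * (v j / v k) := by
  have hcard := hT.card_pos
  have hle : T.card ≤ m := by simpa using T.card_le_univ
  obtain ⟨hP, hPn, -⟩ := opAux_orthogonal hμ hv (T.card - 1) (by omega)
  change (op μ v (T.card - 1)).Monic at hP
  change (op μ v (T.card - 1)).natDegree = T.card - 1 at hPn
  have hpos := ip_self_pos hμ hv hP (by omega)
  have hupper := ip_op_self_le hμ hv hle (monic_prod_X_sub_C μ T)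
    (natDegree_finsetProd_X_sub_C_eq_card T μ)
  have hlower := one_le_ip_self_mul_sum hμ hv hP T (by omega)
  rw [div_le_iff₀ hpos]
  refine hupper.trans ((le_mul_of_one_le_right (ip_self_nonneg μ v hv _) hlower).trans_eq ?_)
  rw [mul_left_comm, mul_comm]
  congr 1
  rw [ip, Finset.sum_mul_sum]
  refine Finset.sum_congr rfl fun j _ => Finset.sum_congr rfl fun k _ => ?_
  simp only [eval_prod, eval_sub, eval_X, eval_C]
  ring

/-- If the weights off `T` become negligible relative to those on `T`, then `a_{2|T|} → 0`. -/
lemma tendsto_fEnt_two_mul_card {m : ℕ} {μ : Fin m → ℝ} (hμ : Function.Injective μ)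
    {w : ℕ → Fin m → ℝ} (hw : ∀ n i, 0 < w n i) (T : Finset (Fin m)) (hT : T.Nonempty)
    (h : ∀ j ∉ T, ∀ k ∈ T, Tendsto (fun n => w n j / w n k) atTop (𝓝 0)) :
    Tendsto (fun n => fEnt μ (w n) (2 * T.card)) atTop (𝓝 0) := by
  have hbound : Tendsto (fun n => ∑ j, ∑ k ∈ T, (∏ t ∈ T, (μ j - μ t)) ^ 2 *
      ((∏ j ∈ T.erase k, (μ k - μ j))⁻¹) ^ 2 * (w n j / w n k)) atTop (𝓝 0) := by
    rw [show (0 : ℝ) = ∑ j : Fin m, ∑ k ∈ T, 0 by simp]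
    refine tendsto_finsetSum _ fun j _ => tendsto_finsetSum _ fun k hk => ?_
    by_cases hj : j ∈ T
    · have : ∏ t ∈ T, (μ j - μ t) = 0 := Finset.prod_eq_zero hj (sub_self _)
      simp [this]
    · simpa only [mul_zero] using (h j hj k hk).const_mul
        ((∏ t ∈ T, (μ j - μ t)) ^ 2 * ((∏ j ∈ T.erase k, (μ k - μ j))⁻¹) ^ 2)
  have hratio := squeeze_zero
    (fun n => div_nonneg (ip_self_nonneg μ (w n) (hw n) (op μ (w n) T.card))
      (ip_self_nonneg μ (w n) (hw n) (op μ (w n) (T.card - 1))))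
    (fun n => ip_op_ratio_le hμ (hw n) T hT) hbound
  simpa [fEnt] using hratio.sqrt

/-- Lemma 13: the entry `a_{2|S₁|}` tends to `0`. -/
theorem stmt3 {d r : ℕ} (hd : 1 ≤ d) (lam : Fin d → ℝ) (hlam : Function.Injective lam)
    (w : ℕ → Fin d → ℝ) (hstab : Stable w)
    (S : Fin r → Finset (Fin d)) (hS : LimPart w S) (hr : 2 ≤ r) :
    Tendsto (fun n => fEnt lam (w n) (2 * (S ⟨0, by omega⟩).card)) atTop (𝓝 0) ∧
    ∀ p q : Fin d, (p : ℕ) + 1 = (S ⟨0, by omega⟩).card →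
      (q : ℕ) = (S ⟨0, by omega⟩).card →
      Tendsto (fun n => Jmat lam (w n) p q) atTop (𝓝 0) := by
  have hT : (S ⟨0, by omega⟩).Nonempty := hS.1.1 _
  have key : Tendsto (fun n => fEnt lam (w n) (2 * (S ⟨0, by omega⟩).card)) atTop (𝓝 0) := by
    refine tendsto_fEnt_two_mul_card hlam hstab.1 _ hT fun j hj k hk => ?_
    obtain ⟨b, -, hb⟩ := Finset.mem_biUnion.1 (hS.1.2.2 ▸ Finset.mem_univ j)
    have hlt : (⟨0, by omega⟩ : Fin r) < b := by
      refine lt_of_le_of_ne (Fin.mk_le_of_le_val (Nat.zero_le _)) ?_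
      rintro rfl
      exact hj hb
    simpa [Pi.inv_def, inv_div] using (hS.2.2 _ b hlt k hk j hb).inv_tendsto_atTop
  refine ⟨key, fun p q hp hq => ?_⟩
  have hpq : p ≠ q := by
    rintro rfl
    omega
  have hidx : (p : ℕ) + q + 1 = 2 * (S ⟨0, by omega⟩).card := by omega
  have hadj : (p : ℕ) + 1 = q := hp.trans hq.symm
  simpa only [Jmat, Matrix.of_apply, if_neg hpq, if_pos (Or.inl hadj : _ ∨ (q : ℕ) + 1 = p), hidx]
    using key
end
end

section
/- There exist a real number U and a real number L > 0 such that: (i) for every J ∈ 𝒥̄^Λ, every i with 0 ≤ i ≤ d, and every k ∈ {1,…,d}, (χ_i(J)(λ_k))² ≤ U; and (ii) for every J ∈ 𝒥̄^Λ, every subset Q ⊆ {1,…,d}, and every i with 0 ≤ i < |Q|, Σ_{k∈Q} (χ_i(J)(λ_k))² ≥ L. -/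
noncomputable section
open Polynomial Filter Topology ENNReal

/-- The sum of the squared entries of a real symmetric matrix equals the sum of the squared
roots of its characteristic polynomial. -/
theorem sum_sq_entries_eq_of_charpoly {d : ℕ} {lam : Fin d → ℝ} {J : Matrix (Fin d) (Fin d) ℝ}
    (hJ : J.IsHermitian) (hchar : J.charpoly = ∏ k, (X - C (lam k))) :
    ∑ i, ∑ j, J i j ^ 2 = ∑ k, lam k ^ 2 := by
  have htrace : ∑ i, ∑ j, J i j ^ 2 = (J * J).trace := by
    simp only [Matrix.trace, Matrix.diag_apply, Matrix.mul_apply, sq]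
    refine Finset.sum_congr rfl fun i _ => Finset.sum_congr rfl fun j _ => ?_
    rw [← hJ.apply j i, star_trivial]
  have hspec : (J * J).trace = ∑ k, hJ.eigenvalues k ^ 2 := by
    conv_lhs => rw [hJ.spectral_theorem, ← map_mul, Unitary.conjStarAlgAut_apply,
      Matrix.trace_mul_comm, ← mul_assoc]
    simp [Matrix.diagonal_mul_diagonal, Matrix.trace_diagonal, sq]
  have hroots : Finset.univ.val.map hJ.eigenvalues = Finset.univ.val.map lam := by
    have h := hJ.roots_charpoly_eq_eigenvalues
    have hprod := roots_multiset_prod_X_sub_C (Finset.univ.val.map lam)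
    rw [Multiset.map_map] at hprod
    rw [hchar] at h
    exact h.symm.trans hprod
  rw [htrace, hspec]
  simpa [List.sum_ofFn] using congrArg (fun s : Multiset ℝ => (s.map (· ^ 2)).sum) hroots

/-- `𝒥̄^Λ` is contained in a compact set of matrices. -/
theorem exists_isCompact_superset_Jset {d : ℕ} (lam : Fin d → ℝ) :
    ∃ K : Set (Matrix (Fin d) (Fin d) ℝ), IsCompact K ∧ Jset lam ⊆ K := by
  set b := √(∑ k, lam k ^ 2)
  refine ⟨Set.univ.pi fun _ => Set.univ.pi fun _ => Set.Icc (-b) b,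
    isCompact_univ_pi fun _ => isCompact_univ_pi fun _ => isCompact_Icc, ?_⟩
  rintro J ⟨hsymm, -, -, hchar⟩ i - j -
  have hsum := sum_sq_entries_eq_of_charpoly (Matrix.IsHermitian.ext fun i j => hsymm j i) hchar
  rw [Set.mem_Icc, ← abs_le]
  refine Real.abs_le_sqrt ?_
  rw [← hsum]
  calc J i j ^ 2 ≤ ∑ j, J i j ^ 2 :=
        Finset.single_le_sum (f := fun j => J i j ^ 2) (fun _ _ => sq_nonneg _) (Finset.mem_univ j)
    _ ≤ ∑ i, ∑ j, J i j ^ 2 :=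
        Finset.single_le_sum (f := fun i => ∑ j, J i j ^ 2)
          (fun _ _ => Finset.sum_nonneg fun _ _ => sq_nonneg _) (Finset.mem_univ i)

theorem continuous_eval_charpoly_leadSub {d : ℕ} (i : ℕ) (hi : i ≤ d) (x : ℝ) :
    Continuous fun J : Matrix (Fin d) (Fin d) ℝ => (leadSub J i hi).charpoly.eval x := by
  simp only [Matrix.eval_charpoly]
  refine Continuous.matrix_det (continuous_const.sub ?_)
  exact continuous_matrix fun a b => continuous_apply_apply _ _

/-- A monic polynomial of degree less than `|Q|` does not vanish at all `lam k`, `k ∈ Q`. -/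
theorem sum_sq_eval_pos {ι : Type*} {lam : ι → ℝ} (hlam : Function.Injective lam) {p : ℝ[X]}
    (hp : p.Monic) {Q : Finset ι} (hQ : p.natDegree < Q.card) :
    0 < ∑ k ∈ Q, p.eval (lam k) ^ 2 := by
  refine (Finset.sum_nonneg fun _ _ => sq_nonneg _).lt_of_ne' fun h => hp.ne_zero ?_
  rw [Finset.sum_eq_zero_iff_of_nonneg fun _ _ => sq_nonneg _] at h
  exact eq_zero_of_degree_lt_of_eval_index_eq_zero Q hlam.injOn
    (degree_le_natDegree.trans_lt (by exact_mod_cast hQ)) fun k hk => pow_eq_zero_iff two_ne_zero |>.mp (h k hk)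

/-- Proposition 11: uniform upper bound `U` on the squared values of
the leading characteristic polynomials, and positive lower bound `L` on subset sums. -/
theorem stmt6 {d : ℕ} (hd : 1 ≤ d) (lam : Fin d → ℝ) (hlam : Function.Injective lam) :
    ∃ U L : ℝ, 0 < L ∧
      (∀ J ∈ Jset lam, ∀ (i : ℕ) (hi : i ≤ d), ∀ k : Fin d,
        ((leadSub J i hi).charpoly.eval (lam k)) ^ 2 ≤ U) ∧
      ∀ J ∈ Jset lam, ∀ Q : Finset (Fin d), ∀ (i : ℕ) (hi : i ≤ d), i < Q.card →
        L ≤ ∑ k ∈ Q, ((leadSub J i hi).charpoly.eval (lam k)) ^ 2 := by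
  obtain ⟨K, hK, hJK⟩ := exists_isCompact_superset_Jset lam
  have hupper : ∀ i : Fin (d + 1), ∀ k : Fin d, ∀ᶠ U in atTop, ∀ J ∈ K,
      ((leadSub J i i.is_le).charpoly.eval (lam k)) ^ 2 ≤ U := fun i k => by
    obtain ⟨U₀, hU₀⟩ := hK.bddAbove_image
      ((continuous_eval_charpoly_leadSub i i.is_le (lam k)).pow 2).continuousOn
    filter_upwards [eventually_ge_atTop U₀] with U hU J hJ
    exact (hU₀ (Set.mem_image_of_mem _ hJ)).trans hU
  have hlower : ∀ Q : Finset (Fin d), ∀ i : Fin (d + 1), ∀ᶠ L in 𝓝[>] (0 : ℝ),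
      (i : ℕ) < Q.card → ∀ J ∈ K,
        L ≤ ∑ k ∈ Q, ((leadSub J i i.is_le).charpoly.eval (lam k)) ^ 2 := fun Q i => by
    rw [eventually_imp_distrib_left]
    intro hQ
    obtain ⟨L₀, hL₀, hle⟩ := hK.exists_forall_le'
      (continuous_finsetSum Q fun k _ =>
        (continuous_eval_charpoly_leadSub i i.is_le (lam k)).pow 2).continuousOn
      fun J _ => sum_sq_eval_pos hlam (leadSub J i i.is_le).charpoly_monic
        (by simpa [Matrix.charpoly_natDegree_eq_dim] using hQ)
    filter_upwards [Ioc_mem_nhdsGT hL₀] with L hL J hJ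
    exact hL.2.trans (hle J hJ)
  obtain ⟨U, hU⟩ := (eventually_all.2 fun i => eventually_all.2 (hupper i)).exists
  obtain ⟨L, hL, hLpos⟩ := ((eventually_all.2 fun Q => eventually_all.2 (hlower Q)).and
    eventually_mem_nhdsWithin).exists
  exact ⟨U, L, hLpos, fun J hJ i hi k => hU ⟨i, Nat.lt_succ_of_le hi⟩ k J (hJK hJ),
    fun J hJ Q i hi hQ => hL Q ⟨i, Nat.lt_succ_of_le hi⟩ hQ J (hJK hJ)⟩
end
end

section
/- If P(R,m) and P(S,n) hold for nonempty subsets R, S ⊆ {1,…,d} and elements m ∈ R, n ∈ S, then R ⊆ S or S ⊆ R. -/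
noncomputable section
open Polynomial Filter Topology ENNReal

/-- If `w R` is nonzero at `m` and `w T` is nonzero at some point of `R ⊆ T`, then `w T` is
nonzero at `m`. -/
theorem ne_zero_of_subset {d : ℕ} {lam : Fin d → ℝ} (hlam : Function.Injective lam) {w : Ew d}
    (heq : ∀ R S : NES d, R.1 ⊆ S.1 → ∀ i ∈ R.1, ∀ j ∈ R.1,
      Cc lam i (S.1 \ R.1) * w R j * w S i = Cc lam j (S.1 \ R.1) * w R i * w S j)
    {R T : NES d} (hRT : R.1 ⊆ T.1) {m k : Fin d} (hm : m ∈ R.1) (hk : k ∈ R.1)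
    (hRm : w R m ≠ 0) (hTk : w T k ≠ 0) : w T m ≠ 0 := by
  have hC : Cc lam k (T.1 \ R.1) ≠ 0 := by
    refine Finset.prod_ne_zero_iff.2 fun t ht => pow_ne_zero _ (sub_ne_zero.2 fun h => ?_)
    exact (Finset.mem_sdiff.1 ht).2 (hlam h ▸ hk)
  intro h0
  have h := heq R T hRT k hk m hm
  rw [h0, mul_zero] at h
  exact mul_ne_zero (mul_ne_zero hC hRm) hTk h

/-- Lemma 3: if `P(R,m)` and `P(S,n)` then `R ⊆ S` or `S ⊆ R`. -/
theorem stmt8 {d : ℕ} (hd : 1 ≤ d) (lam : Fin d → ℝ) (hlam : Function.Injective lam)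
    (w : Ew d)
    (hsupp : ∀ S : NES d, ∀ n, n ∉ S.1 → w S n = 0)
    (hne : ∀ S : NES d, ∃ n ∈ S.1, w S n ≠ 0)
    (heq : ∀ R S : NES d, R.1 ⊆ S.1 → ∀ i ∈ R.1, ∀ j ∈ R.1,
      Cc lam i (S.1 \ R.1) * w R j * w S i = Cc lam j (S.1 \ R.1) * w R i * w S j)
    (R S : NES d) (m n : Fin d) (hm : m ∈ R.1) (hn : n ∈ S.1)
    (hPR : w R m ≠ 0 ∧ ∀ T : NES d, w T m ≠ 0 → T.1.card ≤ R.1.card)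
    (hPS : w S n ≠ 0 ∧ ∀ T : NES d, w T n ≠ 0 → T.1.card ≤ S.1.card) :
    R.1 ⊆ S.1 ∨ S.1 ⊆ R.1 := by
  let T : NES d := ⟨R.1 ∪ S.1, R.2.mono Finset.subset_union_left⟩
  have hRT : R.1 ⊆ T.1 := Finset.subset_union_left
  have hST : S.1 ⊆ T.1 := Finset.subset_union_right
  obtain ⟨k, hkT, hk⟩ := hne T
  rcases Finset.mem_union.1 hkT with hkR | hkS
  · have hcard := hPR.2 T (ne_zero_of_subset hlam heq hRT hm hkR hPR.1 hk)
    exact Or.inr (Finset.eq_of_subset_of_card_le hRT hcard ▸ hST)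
  · have hcard := hPS.2 T (ne_zero_of_subset hlam heq hST hn hkS hPS.1 hk)
    exact Or.inl (Finset.eq_of_subset_of_card_le hST hcard ▸ hRT)
end
end

section
/- For each n ∈ {1,…,d} let φ(n) denote the unique nonempty set with P(φ(n), n) (it exists since w^{{n}}_n ≠ 0, and is unique). Suppose the range of φ is {K_1,…,K_r} with {1,…,d} = K_1 ⊋ K_2 ⊋ … ⊋ K_r. Then for each j ∈ {1,…,r}, {n ∈ {1,…,d} : φ(n) = K_j} = K_j ∖ K_{j+1} (where K_{r+1} = ∅); equivalently, for every i ∈ {1,…,d}, φ(i) is the smallest of the sets K_1,…,K_r containing i. -/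
noncomputable section
open Polynomial Filter Topology ENNReal

theorem Cc_ne_zero {d : ℕ} {lam : Fin d → ℝ} (hlam : Function.Injective lam) {i : Fin d}
    {T : Finset (Fin d)} (hi : i ∉ T) : Cc lam i T ≠ 0 :=
  Finset.prod_ne_zero_iff.2 fun _ ht =>
    pow_ne_zero 2 <| sub_ne_zero.2 fun h => hi (hlam h ▸ ht)

/-- If `n` and `m` lie in `R ⊆ S`, then `w^R_m ≠ 0` and `w^S_n ≠ 0` force `w^S_m ≠ 0`. -/
theorem apply_ne_zero_of_subset {d : ℕ} {lam : Fin d → ℝ} (hlam : Function.Injective lam)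
    {w : Ew d}
    (heq : ∀ R S : NES d, R.1 ⊆ S.1 → ∀ i ∈ R.1, ∀ j ∈ R.1,
      Cc lam i (S.1 \ R.1) * w R j * w S i = Cc lam j (S.1 \ R.1) * w R i * w S j)
    {R S : NES d} (hRS : R.1 ⊆ S.1) {n m : Fin d} (hn : n ∈ R.1) (hm : m ∈ R.1)
    (hRm : w R m ≠ 0) (hSn : w S n ≠ 0) : w S m ≠ 0 := by
  have hC : Cc lam n (S.1 \ R.1) ≠ 0 := Cc_ne_zero hlam fun h => (Finset.mem_sdiff.1 h).2 hn
  have h := mul_ne_zero (mul_ne_zero hC hRm) hSn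
  rw [heq R S hRS n hn m hm] at h
  exact right_ne_zero_of_mul h

/-- Lemma 4: the fibre of `φ` over `K_j` is `K_j ∖ K_{j+1}`. -/
theorem stmt9 {d r : ℕ} (hd : 1 ≤ d) (lam : Fin d → ℝ) (hlam : Function.Injective lam)
    (w : Ew d)
    (hsupp : ∀ S : NES d, ∀ n, n ∉ S.1 → w S n = 0)
    (hne : ∀ S : NES d, ∃ n ∈ S.1, w S n ≠ 0)
    (heq : ∀ R S : NES d, R.1 ⊆ S.1 → ∀ i ∈ R.1, ∀ j ∈ R.1,
      Cc lam i (S.1 \ R.1) * w R j * w S i = Cc lam j (S.1 \ R.1) * w R i * w S j)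
    (φ : Fin d → NES d)
    (hφ : ∀ n : Fin d, w (φ n) n ≠ 0 ∧
      ∀ T : NES d, w T n ≠ 0 → T.1.card ≤ (φ n).1.card)
    (hr : 1 ≤ r) (K : Fin r → Finset (Fin d))
    (hK0 : K ⟨0, hr⟩ = Finset.univ)
    (hchain : ∀ j k : Fin r, j < k → K k ⊂ K j)
    (hrange1 : ∀ n : Fin d, ∃ j : Fin r, (φ n).1 = K j)
    (hrange2 : ∀ j : Fin r, ∃ n : Fin d, (φ n).1 = K j) :
    ∀ j : Fin r, ∀ n : Fin d,
      (φ n).1 = K j ↔ (n ∈ K j ∧ ∀ h : (j : ℕ) + 1 < r, n ∉ K ⟨(j : ℕ) + 1, h⟩) := by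
  have mem_φ (n : Fin d) : n ∈ (φ n).1 := by
    by_contra h
    exact (hφ n).1 (hsupp _ n h)
  have not_mem_of_lt (n : Fin d) (j k : Fin r) (hj : (φ n).1 = K j) (hjk : j < k) :
      n ∉ K k := by
    intro hn
    obtain ⟨m, hm⟩ := hrange2 k
    have hss : (φ m).1 ⊂ (φ n).1 := by rw [hm, hj]; exact hchain j k hjk
    have h := apply_ne_zero_of_subset hlam heq hss.subset (hm ▸ hn) (mem_φ m) (hφ m).1 (hφ n).1
    exact ((hφ m).2 _ h).not_gt (Finset.card_lt_card hss)
  have anti : Antitone K := fun j k hjk => by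
    rcases hjk.eq_or_lt with rfl | h
    · exact le_rfl
    · exact (hchain j k h).subset
  intro j n
  refine ⟨fun hj => ⟨hj ▸ mem_φ n, fun h => not_mem_of_lt n j _ hj (Nat.lt_succ_self j.1)⟩, ?_⟩
  rintro ⟨hn, hn'⟩
  obtain ⟨l, hl⟩ := hrange1 n
  rcases lt_trichotomy l j with h | rfl | h
  · exact absurd hn (not_mem_of_lt n l j hl h)
  · exact hl
  · have hjl : (j : ℕ) + 1 ≤ l := h
    exact absurd (anti (show ⟨(j : ℕ) + 1, hjl.trans_lt l.2⟩ ≤ l from hjl) (hl ▸ mem_φ n)) (hn' _)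
end
end

section
/- The family w̃ satisfies: (a) for every nonempty S ⊆ {1,…,d}, the set S ∩ S_{i(S)} is nonempty, all entries w̃^S_n are ≥ 0, and w̃^S_n > 0 for every n ∈ S ∩ S_{i(S)}; (b) C_i^{S∖R}·w̃^R_j·w̃^S_i = C_j^{S∖R}·w̃^R_i·w̃^S_j for all nonempty R ⊆ S ⊆ {1,…,d} and all i,j ∈ R; and (c) for every j ∈ {1,…,r} and every n ∈ S_j, the set K_j is the unique set of maximal cardinality among the nonempty T ⊆ {1,…,d} with w̃^T_n ≠ 0, and moreover w̃^{K_j}_n = v^{(j)}_n. -/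
noncomputable section
open Polynomial Filter Topology ENNReal

theorem mem_Kof {d r : ℕ} {S : Fin r → Finset (Fin d)} {j : Fin r} {n : Fin d} :
    n ∈ Kof S j ↔ ∃ k, j ≤ k ∧ n ∈ S k := by
  simp [Kof]

theorem OrdPart.eq_of_mem {d r : ℕ} {S : Fin r → Finset (Fin d)} (hS : OrdPart S)
    {j k : Fin r} {n : Fin d} (hj : n ∈ S j) (hk : n ∈ S k) : j = k := by
  by_contra h
  exact Finset.disjoint_left.mp (hS.2.1 j k h) hj hk

theorem OrdPart.le_of_mem_Kof {d r : ℕ} {S : Fin r → Finset (Fin d)} (hS : OrdPart S)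
    {j k : Fin r} {n : Fin d} (hj : n ∈ S j) (hk : n ∈ Kof S k) : k ≤ j := by
  obtain ⟨l, hl, hn⟩ := mem_Kof.mp hk
  rwa [hS.eq_of_mem hj hn]

theorem subset_Kof_of_disjoint {d r : ℕ} {S : Fin r → Finset (Fin d)} {T : Finset (Fin d)}
    {j : Fin r} (hT : T.Nonempty) (hj : T ⊆ Kof S j) (hdis : ∀ n ∈ T, n ∉ S j) :
    ∃ k, j < k ∧ T ⊆ Kof S k := by
  have above : ∀ n ∈ T, ∃ k, j < k ∧ n ∈ S k := by
    intro n hn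
    obtain ⟨k, hk, hnk⟩ := mem_Kof.mp (hj hn)
    refine ⟨k, lt_of_le_of_ne hk ?_, hnk⟩
    rintro rfl
    exact hdis n hn hnk
  obtain ⟨t, ht⟩ := hT
  obtain ⟨l, hjl, -⟩ := above t ht
  have hlt : (j : ℕ) + 1 < r := lt_of_le_of_lt (Nat.succ_le_of_lt hjl) l.2
  refine ⟨⟨j + 1, hlt⟩, Fin.lt_def.mpr (Nat.lt_succ_self _), fun n hn => ?_⟩
  obtain ⟨k, hk, hnk⟩ := above n hn
  exact mem_Kof.mpr ⟨k, Nat.succ_le_of_lt hk, hnk⟩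

theorem Cc_pos {d : ℕ} {lam : Fin d → ℝ} (hlam : Function.Injective lam) {i : Fin d}
    {T : Finset (Fin d)} (hi : i ∉ T) : 0 < Cc lam i T := by
  refine Finset.prod_pos fun t ht => sq_pos_of_ne_zero (sub_ne_zero.mpr ?_)
  exact fun h => hi (hlam h ▸ ht)

theorem Cc_sdiff_mul_sdiff {d : ℕ} (lam : Fin d → ℝ) (i : Fin d) {R T K : Finset (Fin d)}
    (hRT : R ⊆ T) (hTK : T ⊆ K) :
    Cc lam i (T \ R) * Cc lam i (K \ T) = Cc lam i (K \ R) := by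
  have h : K \ R = (T \ R) ∪ (K \ T) := by
    ext n
    have := @hRT n
    have := @hTK n
    simp only [Finset.mem_sdiff, Finset.mem_union]
    tauto
  rw [h, Cc, Cc, Cc, Finset.prod_union]
  exact Finset.disjoint_left.mpr fun n hn hn' =>
    (Finset.mem_sdiff.mp hn').2 (Finset.mem_sdiff.mp hn).1

/-- the family `w̃` defined from an ordered partition and positive
weights satisfies the inequalities, equations and maximality properties. -/
theorem stmt10 {d r : ℕ} (hd : 1 ≤ d) (lam : Fin d → ℝ) (hlam : Function.Injective lam)
    (S : Fin r → Finset (Fin d)) (hS : OrdPart S)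
    (iS : NES d → Fin r)
    (hiS : ∀ T : NES d, T.1 ⊆ Kof S (iS T) ∧ ∀ j : Fin r, T.1 ⊆ Kof S j → j ≤ iS T)
    (v : Fin r → Fin d → ℝ)
    (hvpos : ∀ j, ∀ n ∈ S j, 0 < v j n) (hv0 : ∀ j, ∀ n, n ∉ S j → v j n = 0)
    (wt : Ew d)
    (hwt : ∀ (T : NES d) (n : Fin d), wt T n =
      if n ∈ T.1 ∩ S (iS T) then Cc lam n (Kof S (iS T) \ T.1) * v (iS T) n else 0) :
    (∀ T : NES d, (T.1 ∩ S (iS T)).Nonempty ∧ (∀ n, 0 ≤ wt T n) ∧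
      ∀ n ∈ T.1 ∩ S (iS T), 0 < wt T n) ∧
    (∀ R T : NES d, R.1 ⊆ T.1 → ∀ i ∈ R.1, ∀ j ∈ R.1,
      Cc lam i (T.1 \ R.1) * wt R j * wt T i = Cc lam j (T.1 \ R.1) * wt R i * wt T j) ∧
    ∀ j : Fin r, ∀ n ∈ S j, ∀ hK : (Kof S j).Nonempty,
      wt ⟨Kof S j, hK⟩ n ≠ 0 ∧
      (∀ T : NES d, wt T n ≠ 0 → T.1.card ≤ (Kof S j).card) ∧
      (∀ T : NES d, wt T n ≠ 0 → T.1.card = (Kof S j).card → T.1 = Kof S j) ∧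
      wt ⟨Kof S j, hK⟩ n = v j n := by
  have pos : ∀ T : NES d, ∀ n ∈ T.1 ∩ S (iS T), 0 < wt T n := by
    intro T n hn
    rw [hwt, if_pos hn]
    refine mul_pos (Cc_pos hlam fun h => ?_) (hvpos _ _ (Finset.mem_inter.mp hn).2)
    exact (Finset.mem_sdiff.mp h).2 (Finset.mem_inter.mp hn).1
  have zero : ∀ T : NES d, ∀ n ∉ S (iS T), wt T n = 0 := by
    intro T n hn
    rw [hwt, if_neg fun h => hn (Finset.mem_inter.mp h).2]
  refine ⟨fun T => ⟨?_, fun n => ?_, pos T⟩, fun R T hRT i hi j hj => ?_, fun j n hn hK => ?_⟩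
  · by_contra hne
    obtain ⟨k, hk, hTk⟩ := subset_Kof_of_disjoint T.2 (hiS T).1
      fun n hn hn' => hne ⟨n, Finset.mem_inter.mpr ⟨hn, hn'⟩⟩
    exact absurd ((hiS T).2 k hTk) (not_le.mpr hk)
  · by_cases hn : n ∈ T.1 ∩ S (iS T)
    · exact (pos T n hn).le
    · rw [hwt, if_neg hn]
  · have hle : iS T ≤ iS R := (hiS R).2 _ (hRT.trans (hiS T).1)
    rcases hle.lt_or_eq with hlt | heq
    · have vanish : ∀ k ∈ R.1, wt T k = 0 := fun k hk => zero T k fun hkS =>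
        absurd (hS.le_of_mem_Kof hkS ((hiS R).1 hk)) (not_le.mpr hlt)
      rw [vanish i hi, vanish j hj, mul_zero, mul_zero]
    · by_cases hiT : i ∈ S (iS T)
      · by_cases hjT : j ∈ S (iS T)
        · rw [hwt R j, hwt R i, hwt T j, hwt T i, ← heq,
            if_pos (Finset.mem_inter.mpr ⟨hj, hjT⟩), if_pos (Finset.mem_inter.mpr ⟨hi, hiT⟩),
            if_pos (Finset.mem_inter.mpr ⟨hRT hj, hjT⟩),
            if_pos (Finset.mem_inter.mpr ⟨hRT hi, hiT⟩),
            ← Cc_sdiff_mul_sdiff lam i hRT (hiS T).1, ← Cc_sdiff_mul_sdiff lam j hRT (hiS T).1]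
          ring
        · rw [zero T j hjT, zero R j (heq ▸ hjT)]
          ring
      · rw [zero T i hiT, zero R i (heq ▸ hiT)]
        ring
  · have hiK : iS ⟨Kof S j, hK⟩ = j :=
      le_antisymm
        (hS.le_of_mem_Kof hn ((hiS ⟨Kof S j, hK⟩).1 (mem_Kof.mpr ⟨j, le_rfl, hn⟩)))
        ((hiS ⟨Kof S j, hK⟩).2 j (Finset.Subset.refl _))
    have hnK : n ∈ Kof S j := mem_Kof.mpr ⟨j, le_rfl, hn⟩
    have hsub : ∀ T : NES d, wt T n ≠ 0 → T.1 ⊆ Kof S j := by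
      intro T hT
      have hnT : n ∈ S (iS T) := by
        by_contra h
        exact hT (zero T n h)
      rw [hS.eq_of_mem hn hnT]
      exact (hiS T).1
    have hval : wt ⟨Kof S j, hK⟩ n = v j n := by
      rw [hwt, hiK, if_pos (Finset.mem_inter.mpr ⟨hnK, hn⟩)]
      simp [Cc]
    exact ⟨hval ▸ (hvpos j n hn).ne', fun T hT => Finset.card_le_card (hsub T hT),
      fun T hT hc => Finset.eq_of_subset_of_card_le (hsub T hT) hc.ge, hval⟩
end
end
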